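/- Uniform blow-up time for the family of parabolic PDEs: let A := (1/2)∫₀^{2π} [F₀(θ), F₀'(θ)] dθ, where F₀(θ) = ( −∫₀^θ ((g+g'')/u₀)(σ) sin σ dσ , ∫₀^θ ((g+g'')/u₀)(σ) cos σ dσ ) and [x,y] := x₁y₂ − x₂y₁, and let B := (1/2)∫₀^{2π} g(θ)(g(θ)+g''(θ)) dθ. Then for every smooth positive nondecreasing f : [0,∞) → ℝ with f(0) = 1, there is no T' > A/(2B) admitting a smooth function u : ℝ × [0,T'] → ℝ, 2π-periodic and strictly positive in θ, with u(θ,0) = u₀(θ) and satisfying ∂u/∂t = (g/(g+g''))u²u_{θθ} + (2g'/(g+g''))u²u_θ + u³ + (f'(t)/f(t))u on ℝ × [0,T']; that is, every such solution, or one of its derivatives, blows up by time T = A/(2B), a bound depending only on g and u₀. -/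

import Mathlib

open Real Set

noncomputable def wedge (x y : ℝ × ℝ) : ℝ := x.1 * y.2 - x.2 * y.1

noncomputable def er (θ : ℝ) : ℝ × ℝ := (Real.cos θ, Real.sin θ)

noncomputable def etheta (θ : ℝ) : ℝ × ℝ := (-Real.sin θ, Real.cos θ)

/-- partial derivative in the first (spatial) variable -/
noncomputable def pd (f : ℝ → ℝ → ℝ) (θ t : ℝ) : ℝ := deriv (fun x => f x t) θ

/-- partial derivative in the second (time) variable -/
noncomputable def pt (f : ℝ → ℝ → ℝ) (θ t : ℝ) : ℝ := deriv (fun s => f θ s) t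

/-- partial derivative in the first variable, vector valued -/
noncomputable def pdv (f : ℝ → ℝ → ℝ × ℝ) (θ t : ℝ) : ℝ × ℝ := deriv (fun x => f x t) θ

/-- partial derivative in the second variable, vector valued -/
noncomputable def ptv (f : ℝ → ℝ → ℝ × ℝ) (θ t : ℝ) : ℝ × ℝ := deriv (fun s => f θ s) t

open intervalIntegral MeasureTheory in
/-- Differentiation under the integral sign for jointly continuous integrands. -/
theorem hasDerivAt_integral_of_continuous {φ ψ : ℝ → ℝ → ℝ} (hφ : Continuous φ.uncurry)
    (hψ : Continuous ψ.uncurry) {s : Set ℝ} {t : ℝ} (hs : s ∈ nhds t)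
    (h : ∀ r ∈ s, ∀ θ, HasDerivAt (fun r => φ r θ) (ψ r θ) r) (a b : ℝ) :
    HasDerivAt (fun r => ∫ θ in a..b, φ r θ) (∫ θ in a..b, ψ t θ) t := by
  have hφr : ∀ r, Continuous (φ r) := fun r => hφ.comp (Continuous.prodMk_right r)
  have hψr : ∀ r, Continuous (ψ r) := fun r => hψ.comp (Continuous.prodMk_right r)
  obtain ⟨ε, hε, hball⟩ := Metric.mem_nhds_iff.1 hs
  obtain ⟨C, hC⟩ := ((isCompact_closedBall t ε).prod
    (isCompact_uIcc (a := a) (b := b))).exists_bound_of_continuousOn hψ.continuousOn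
  refine (hasDerivAt_integral_of_dominated_loc_of_deriv_le (bound := fun _ => C)
    (Metric.ball_mem_nhds t hε) (.of_forall fun r => (hφr r).aestronglyMeasurable)
    ((hφr t).intervalIntegrable _ _) (hψr t).aestronglyMeasurable
    (.of_forall fun θ hθ r hr => ?_) intervalIntegrable_const
    (.of_forall fun θ _ r hr => h r (hball hr) θ)).2
  exact hC (r, θ) ⟨Metric.ball_subset_closedBall hr, uIoc_subset_uIcc hθ⟩

/-- The solution `h` of `h + deriv (deriv h) = w` with vanishing initial data, that is,
the support function of
the curve starting at the origin with radius of curvature `w`. -/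
noncomputable def supportFun (w : ℝ → ℝ) (θ : ℝ) : ℝ :=
  sin θ * (∫ σ in (0:ℝ)..θ, w σ * cos σ) - cos θ * ∫ σ in (0:ℝ)..θ, w σ * sin σ

theorem supportFun_eq_integral {w : ℝ → ℝ} (hw : Continuous w) (θ : ℝ) :
    supportFun w θ = ∫ σ in (0:ℝ)..θ, w σ * sin (θ - σ) := by
  rw [supportFun, ← intervalIntegral.integral_const_mul, ← intervalIntegral.integral_const_mul,
    ← intervalIntegral.integral_sub (by apply Continuous.intervalIntegrable; fun_prop)
      (by apply Continuous.intervalIntegrable; fun_prop)]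
  refine intervalIntegral.integral_congr fun σ _ => ?_
  simp only [sin_sub]
  ring

theorem supportFun_nonneg {w : ℝ → ℝ} (hw : Continuous w) (hpos : ∀ θ, 0 ≤ w θ)
    (hcos : ∫ σ in (0:ℝ)..2 * π, w σ * cos σ = 0) (hsin : ∫ σ in (0:ℝ)..2 * π, w σ * sin σ = 0)
    {θ : ℝ} (hθ : θ ∈ Icc 0 (2 * π)) : 0 ≤ supportFun w θ := by
  obtain ⟨h0, h1⟩ := hθ
  rcases le_total θ π with h | h
  · rw [supportFun_eq_integral hw]
    refine intervalIntegral.integral_nonneg h0 fun σ hσ => mul_nonneg (hpos σ) ?_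
    exact sin_nonneg_of_nonneg_of_le_pi (by linarith [hσ.2]) (by linarith [hσ.1])
  · have hi : ∀ a b, IntervalIntegrable (fun σ => w σ * cos σ) MeasureTheory.volume a b :=
      fun a b => Continuous.intervalIntegrable (by fun_prop) _ _
    have hj : ∀ a b, IntervalIntegrable (fun σ => w σ * sin σ) MeasureTheory.volume a b :=
      fun a b => Continuous.intervalIntegrable (by fun_prop) _ _
    have e1 := intervalIntegral.integral_add_adjacent_intervals (hi 0 θ) (hi θ (2 * π))
    have e2 := intervalIntegral.integral_add_adjacent_intervals (hj 0 θ) (hj θ (2 * π))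
    have : supportFun w θ = ∫ σ in θ..2 * π, w σ * sin (σ - θ) := by
      have e3 : ∫ σ in θ..2 * π, w σ * sin (σ - θ)
          = cos θ * (∫ σ in θ..2 * π, w σ * sin σ) - sin θ * ∫ σ in θ..2 * π, w σ * cos σ := by
        rw [← intervalIntegral.integral_const_mul, ← intervalIntegral.integral_const_mul,
          ← intervalIntegral.integral_sub ((hj _ _).const_mul _) ((hi _ _).const_mul _)]
        refine intervalIntegral.integral_congr fun σ _ => ?_
        simp only [sin_sub]
        ring
      rw [e3, supportFun]
      linear_combination sin θ * (e1 + hcos) - cos θ * (e2 + hsin)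
    rw [this]
    refine intervalIntegral.integral_nonneg h1 fun σ hσ => mul_nonneg (hpos σ) ?_
    exact sin_nonneg_of_nonneg_of_le_pi (by linarith [hσ.1]) (by linarith [hσ.2])

theorem continuous_supportFun {X : Type*} [TopologicalSpace X] {W : X → ℝ → ℝ}
    (hW : Continuous W.uncurry) : Continuous fun q : X × ℝ => supportFun (W q.1) q.2 := by
  have h1 : Continuous fun q : X × ℝ => ∫ σ in (0:ℝ)..q.2, W q.1 σ * cos σ :=
    intervalIntegral.continuous_parametric_primitive_of_continuous (f := fun x σ => W x σ * cos σ)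
      (hW.mul (by fun_prop))
  have h2 : Continuous fun q : X × ℝ => ∫ σ in (0:ℝ)..q.2, W q.1 σ * sin σ :=
    intervalIntegral.continuous_parametric_primitive_of_continuous (f := fun x σ => W x σ * sin σ)
      (hW.mul (by fun_prop))
  unfold supportFun
  fun_prop

theorem Continuous.supportFun {w : ℝ → ℝ} (hw : Continuous w) : Continuous (supportFun w) := by
  have h1 : Continuous fun θ => ∫ σ in (0:ℝ)..θ, w σ * cos σ :=
    intervalIntegral.continuous_primitive
      (fun _ _ => Continuous.intervalIntegrable (by fun_prop) _ _) 0
  have h2 : Continuous fun θ => ∫ σ in (0:ℝ)..θ, w σ * sin σ :=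
    intervalIntegral.continuous_primitive
      (fun _ _ => Continuous.intervalIntegrable (by fun_prop) _ _) 0
  exact (continuous_sin.mul h1).sub (continuous_cos.mul h2)

section SecondOrder

variable {p p₁ p₂ : ℝ → ℝ}

theorem integral_add_second_deriv_mul_cos (hp : ∀ θ, HasDerivAt p (p₁ θ) θ)
    (hp₁ : ∀ θ, HasDerivAt p₁ (p₂ θ) θ) (hp₂ : Continuous p₂) (θ : ℝ) :
    ∫ σ in (0:ℝ)..θ, (p₂ σ + p σ) * cos σ = p₁ θ * cos θ + p θ * sin θ - p₁ 0 := by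
  have hc : Continuous p := continuous_iff_continuousAt.2 fun θ => (hp θ).continuousAt
  rw [intervalIntegral.integral_eq_sub_of_hasDerivAt
    (f := fun σ => p₁ σ * cos σ + p σ * sin σ) (fun σ _ => ?_)
    (by apply Continuous.intervalIntegrable; fun_prop)]
  · simp
  · exact (((hp₁ σ).mul (hasDerivAt_cos σ)).add ((hp σ).mul (hasDerivAt_sin σ))).congr_deriv
      (by ring)

theorem integral_add_second_deriv_mul_sin (hp : ∀ θ, HasDerivAt p (p₁ θ) θ)
    (hp₁ : ∀ θ, HasDerivAt p₁ (p₂ θ) θ) (hp₂ : Continuous p₂) (θ : ℝ) :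
    ∫ σ in (0:ℝ)..θ, (p₂ σ + p σ) * sin σ = p₁ θ * sin θ - p θ * cos θ + p 0 := by
  have hc : Continuous p := continuous_iff_continuousAt.2 fun θ => (hp θ).continuousAt
  rw [intervalIntegral.integral_eq_sub_of_hasDerivAt
    (f := fun σ => p₁ σ * sin σ - p σ * cos σ) (fun σ _ => ?_)
    (by apply Continuous.intervalIntegrable; fun_prop)]
  · simp
  · exact (((hp₁ σ).mul (hasDerivAt_sin σ)).sub ((hp σ).mul (hasDerivAt_cos σ))).congr_deriv
      (by ring)

theorem supportFun_add_second_deriv (hp : ∀ θ, HasDerivAt p (p₁ θ) θ)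
    (hp₁ : ∀ θ, HasDerivAt p₁ (p₂ θ) θ) (hp₂ : Continuous p₂) (θ : ℝ) :
    supportFun (fun σ => p₂ σ + p σ) θ = p θ - p₁ 0 * sin θ - p 0 * cos θ := by
  rw [supportFun, integral_add_second_deriv_mul_cos hp hp₁ hp₂,
    integral_add_second_deriv_mul_sin hp hp₁ hp₂]
  linear_combination p θ * sin_sq_add_cos_sq θ

theorem integral_add_second_deriv_mul_supportFun (hp : ∀ θ, HasDerivAt p (p₁ θ) θ)
    (hp₁ : ∀ θ, HasDerivAt p₁ (p₂ θ) θ) (hp₂ : Continuous p₂) {w : ℝ → ℝ} (hw : Continuous w)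
    (hcos : ∫ σ in (0:ℝ)..2 * π, w σ * cos σ = 0)
    (hsin : ∫ σ in (0:ℝ)..2 * π, w σ * sin σ = 0) :
    ∫ θ in (0:ℝ)..2 * π, (p₂ θ + p θ) * supportFun w θ = ∫ θ in (0:ℝ)..2 * π, p θ * w θ := by
  have hc : Continuous p := continuous_iff_continuousAt.2 fun θ => (hp θ).continuousAt
  have hC : ∀ θ, HasDerivAt (fun θ => ∫ σ in (0:ℝ)..θ, w σ * cos σ) (w θ * cos θ) θ := fun θ =>
    (Continuous.integral_hasStrictDerivAt (by fun_prop) 0 θ).hasDerivAt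
  have hS : ∀ θ, HasDerivAt (fun θ => ∫ σ in (0:ℝ)..θ, w σ * sin σ) (w θ * sin θ) θ := fun θ =>
    (Continuous.integral_hasStrictDerivAt (by fun_prop) 0 θ).hasDerivAt
  set C : ℝ → ℝ := fun θ => ∫ σ in (0:ℝ)..θ, w σ * cos σ with hCdef
  set S : ℝ → ℝ := fun θ => ∫ σ in (0:ℝ)..θ, w σ * sin σ with hSdef
  have hCc : Continuous C := continuous_iff_continuousAt.2 fun θ => (hC θ).continuousAt
  have hSc : Continuous S := continuous_iff_continuousAt.2 fun θ => (hS θ).continuousAt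
  have hs : ∀ θ, supportFun w θ = sin θ * C θ - cos θ * S θ := fun θ => rfl
  simp only [hs]
  rw [← sub_eq_zero, ← intervalIntegral.integral_sub
    (by apply Continuous.intervalIntegrable; fun_prop)
    (by apply Continuous.intervalIntegrable; fun_prop),
    intervalIntegral.integral_eq_sub_of_hasDerivAt
    (f := fun θ => p₁ θ * (sin θ * C θ - cos θ * S θ) - p θ * (cos θ * C θ + sin θ * S θ))
    (fun θ _ => ?_) (by apply Continuous.intervalIntegrable; fun_prop)]
  · simp [hCdef, hSdef, hcos, hsin]
  · have hh : HasDerivAt (fun θ => sin θ * C θ - cos θ * S θ) (cos θ * C θ + sin θ * S θ) θ :=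
      (((hasDerivAt_sin θ).mul (hC θ)).sub ((hasDerivAt_cos θ).mul (hS θ))).congr_deriv (by ring)
    have hh' : HasDerivAt (fun θ => cos θ * C θ + sin θ * S θ)
        (w θ - (sin θ * C θ - cos θ * S θ)) θ :=
      (((hasDerivAt_cos θ).mul (hC θ)).add ((hasDerivAt_sin θ).mul (hS θ))).congr_deriv
        (by linear_combination w θ * sin_sq_add_cos_sq θ)
    exact (((hp₁ θ).mul hh).sub ((hp θ).mul hh')).congr_deriv (by ring)

theorem integral_first_variation (hp : ∀ θ, HasDerivAt p (p₁ θ) θ)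
    (hp₁ : ∀ θ, HasDerivAt p₁ (p₂ θ) θ) (hp₂ : Continuous p₂) {w : ℝ → ℝ} (hw : Continuous w)
    (hcos : ∫ σ in (0:ℝ)..2 * π, w σ * cos σ = 0)
    (hsin : ∫ σ in (0:ℝ)..2 * π, w σ * sin σ = 0) :
    ∫ θ in (0:ℝ)..2 * π, (-(p₂ θ + p θ) * supportFun w θ
      + w θ * supportFun (fun σ => -(p₂ σ + p σ)) θ) = -2 * ∫ θ in (0:ℝ)..2 * π, p θ * w θ := by
  have hc : Continuous p := continuous_iff_continuousAt.2 fun θ => (hp θ).continuousAt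
  have hS : Continuous (supportFun w) := hw.supportFun
  have hneg : ∀ θ, supportFun (fun σ => -(p₂ σ + p σ)) θ
      = -(p θ - p₁ 0 * sin θ - p 0 * cos θ) := fun θ => by
    rw [← supportFun_add_second_deriv hp hp₁ hp₂]
    simp only [supportFun, neg_mul, intervalIntegral.integral_neg]
    ring
  have e : ∀ θ, -(p₂ θ + p θ) * supportFun w θ + w θ * supportFun (fun σ => -(p₂ σ + p σ)) θ
      = -((p₂ θ + p θ) * supportFun w θ) - p θ * w θ
        + (p₁ 0 * (w θ * sin θ) + p 0 * (w θ * cos θ)) := fun θ => by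
    rw [hneg]
    ring
  simp only [e]
  have i₁ : Continuous fun θ => (p₂ θ + p θ) * supportFun w θ := (hp₂.add hc).mul hS
  have i₂ : Continuous fun θ => p θ * w θ := hc.mul hw
  have i₃ : Continuous fun θ => p₁ 0 * (w θ * sin θ) := by fun_prop
  have i₄ : Continuous fun θ => p 0 * (w θ * cos θ) := by fun_prop
  have i₁' : Continuous fun θ => -((p₂ θ + p θ) * supportFun w θ) := i₁.neg
  have i₁₂ : Continuous fun θ => -((p₂ θ + p θ) * supportFun w θ) - p θ * w θ := i₁'.sub i₂
  have i₃₄ : Continuous fun θ => p₁ 0 * (w θ * sin θ) + p 0 * (w θ * cos θ) := i₃.add i₄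
  rw [intervalIntegral.integral_add (i₁₂.intervalIntegrable _ _) (i₃₄.intervalIntegrable _ _),
    intervalIntegral.integral_sub (i₁'.intervalIntegrable _ _) (i₂.intervalIntegrable _ _),
    intervalIntegral.integral_add (i₃.intervalIntegrable _ _) (i₄.intervalIntegrable _ _),
    intervalIntegral.integral_neg, intervalIntegral.integral_const_mul,
    intervalIntegral.integral_const_mul, hcos, hsin,
    integral_add_second_deriv_mul_supportFun hp hp₁ hp₂ hw hcos hsin]
  ring

end SecondOrder

section Flow

variable {W P P₁ P₂ : ℝ → ℝ → ℝ} {s : Set ℝ} {t : ℝ}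

/-- Differentiation of the moments of a density `W` with velocity `V`. -/
theorem hasDerivAt_integral_mul {V : ℝ → ℝ → ℝ} (hW : Continuous W.uncurry)
    (hV : Continuous V.uncurry) (hs : s ∈ nhds t)
    (h : ∀ r ∈ s, ∀ θ, HasDerivAt (fun r => W r θ) (V r θ) r) {c : ℝ → ℝ} (hc : Continuous c)
    (a b : ℝ) :
    HasDerivAt (fun r => ∫ θ in a..b, W r θ * c θ) (∫ θ in a..b, V t θ * c θ) t :=
  hasDerivAt_integral_of_continuous (φ := fun r θ => W r θ * c θ) (ψ := fun r θ => V r θ * c θ)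
    (hW.mul (hc.comp continuous_snd)) (hV.mul (hc.comp continuous_snd)) hs
    (fun r hr θ => (h r hr θ).mul_const _) a b

theorem hasDerivAt_supportFun {V : ℝ → ℝ → ℝ} (hW : Continuous W.uncurry)
    (hV : Continuous V.uncurry) (hs : s ∈ nhds t)
    (h : ∀ r ∈ s, ∀ θ, HasDerivAt (fun r => W r θ) (V r θ) r) (θ : ℝ) :
    HasDerivAt (fun r => supportFun (W r) θ) (supportFun (V t) θ) t :=
  ((hasDerivAt_integral_mul hW hV hs h continuous_cos 0 θ).const_mul _).sub
    ((hasDerivAt_integral_mul hW hV hs h continuous_sin 0 θ).const_mul _)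

/-- First variation of twice the enclosed area when the radius of curvature `W` moves with
velocity `-(P₂ + P)`, where `P₂` is the second derivative of `P` along the curve. -/
theorem hasDerivAt_integral_mul_supportFun (hW : Continuous W.uncurry)
    (hP₂ : Continuous P₂.uncurry) (hP : Continuous P.uncurry)
    (hd : ∀ r θ, HasDerivAt (P r) (P₁ r θ) θ) (hd₁ : ∀ r θ, HasDerivAt (P₁ r) (P₂ r θ) θ)
    (hs : IsOpen s) (ht : t ∈ s)
    (h : ∀ r ∈ s, ∀ θ, HasDerivAt (fun r => W r θ) (-(P₂ r θ + P r θ)) r)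
    (hcos : ∫ σ in (0:ℝ)..2 * π, W t σ * cos σ = 0)
    (hsin : ∫ σ in (0:ℝ)..2 * π, W t σ * sin σ = 0) :
    HasDerivAt (fun r => ∫ θ in (0:ℝ)..2 * π, W r θ * supportFun (W r) θ)
      (-2 * ∫ θ in (0:ℝ)..2 * π, P t θ * W t θ) t := by
  obtain ⟨V, hVe⟩ : ∃ V : ℝ → ℝ → ℝ, V = fun r θ => -(P₂ r θ + P r θ) := ⟨_, rfl⟩
  have hV : Continuous V.uncurry := by
    rw [hVe]
    exact (hP₂.add hP).neg
  have h' : ∀ r ∈ s, ∀ θ, HasDerivAt (fun r => W r θ) (V r θ) r := by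
    rw [hVe]
    exact h
  have key := hasDerivAt_integral_of_continuous (φ := fun r θ => W r θ * supportFun (W r) θ)
    (ψ := fun r θ => V r θ * supportFun (W r) θ + W r θ * supportFun (V r) θ)
    (hW.mul (continuous_supportFun hW))
    ((hV.mul (continuous_supportFun hW)).add (hW.mul (continuous_supportFun hV)))
    (hs.mem_nhds ht)
    (fun r hr θ => (h' r hr θ).mul (hasDerivAt_supportFun hW hV (hs.mem_nhds hr) h' θ)) 0 (2 * π)
  refine key.congr_deriv ?_
  rw [hVe]
  exact integral_first_variation (hd t) (hd₁ t) (hP₂.comp (Continuous.prodMk_right t))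
    (hW.comp (Continuous.prodMk_right t)) hcos hsin

end Flow

/-- A continuous function on `[a, b]` with zero derivative inside takes equal values. -/
theorem eq_left_of_hasDerivAt_zero {φ : ℝ → ℝ} (hφ : Continuous φ) {a b : ℝ}
    (h : ∀ t ∈ Ioo a b, HasDerivAt φ 0 t) {t : ℝ} (ht : t ∈ Icc a b) : φ t = φ a := by
  have := intervalIntegral.integral_eq_sub_of_hasDerivAt_of_le ht.1 hφ.continuousOn
    (fun x hx => h x ⟨hx.1, hx.2.trans_le ht.2⟩) intervalIntegrable_const
  simp only [intervalIntegral.integral_zero] at this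
  linarith

theorem Function.Periodic.of_hasDerivAt {p p₁ : ℝ → ℝ} {c : ℝ} (hper : Function.Periodic p c)
    (hp : ∀ θ, HasDerivAt p (p₁ θ) θ) : Function.Periodic p₁ c := fun θ => by
  have h := (hp (θ + c)).comp_add_const θ c
  rw [show (fun x => p (x + c)) = p from funext hper] at h
  exact h.unique (hp θ)

theorem contDiff_pd {u : ℝ → ℝ → ℝ} (hu : ContDiff ℝ (⊤ : ℕ∞) u.uncurry) :
    ContDiff ℝ (⊤ : ℕ∞) (pd u).uncurry ∧ ∀ θ t, HasDerivAt (fun x => u x t) (pd u θ t) θ := by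
  have hd : ∀ θ t, HasDerivAt (fun x => u x t) (fderiv ℝ u.uncurry (θ, t) (1, 0)) θ := fun θ t =>
    ((hu.differentiable (by simp)) (θ, t)).hasFDerivAt.comp_hasDerivAt (f := fun x => (x, t)) θ
      ((hasDerivAt_id θ).prodMk (hasDerivAt_const θ t))
  have e : (pd u).uncurry = fun q => fderiv ℝ u.uncurry q (1, 0) := by
    ext ⟨θ, t⟩
    exact (hd θ t).deriv
  refine ⟨?_, fun θ t => (hd θ t).differentiableAt.hasDerivAt⟩
  rw [e]
  exact (hu.fderiv_right (by simp)).clm_apply contDiff_const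

theorem hasDerivAt_pt {u : ℝ → ℝ → ℝ} (hu : ContDiff ℝ (⊤ : ℕ∞) u.uncurry) (θ t : ℝ) :
    HasDerivAt (u θ) (pt u θ t) t :=
  (((hu.differentiable (by simp)) (θ, t)).comp t
    ((differentiableAt_const θ).prodMk differentiableAt_id)).hasDerivAt

theorem stmt19
    (g : ℝ → ℝ) (hg : ContDiff ℝ (⊤ : ℕ∞) g)
    (hgper : ∀ θ, g (θ + π) = g θ)
    (hgpos : ∀ θ, 0 < g θ)
    (hggpos : ∀ θ, 0 < g θ + deriv (deriv g) θ)
    (u₀ : ℝ → ℝ) (hu₀ : ContDiff ℝ (⊤ : ℕ∞) u₀)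
    (hu₀per : ∀ θ, u₀ (θ + 2 * π) = u₀ θ)
    (hu₀pos : ∀ θ, 0 < u₀ θ)
    (hclose1 : (∫ θ in (0:ℝ)..2 * π, (g θ + deriv (deriv g) θ) / u₀ θ * Real.sin θ) = 0)
    (hclose2 : (∫ θ in (0:ℝ)..2 * π, (g θ + deriv (deriv g) θ) / u₀ θ * Real.cos θ) = 0)
    (F₀ : ℝ → ℝ × ℝ)
    (hF₀ : ∀ θ, F₀ θ =
      (-(∫ σ in (0:ℝ)..θ, (g σ + deriv (deriv g) σ) / u₀ σ * Real.sin σ),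
        ∫ σ in (0:ℝ)..θ, (g σ + deriv (deriv g) σ) / u₀ σ * Real.cos σ))
    (A B : ℝ)
    (hA : A = (1 / 2) * ∫ θ in (0:ℝ)..2 * π, wedge (F₀ θ) (deriv F₀ θ))
    (hB : B = (1 / 2) * ∫ θ in (0:ℝ)..2 * π, g θ * (g θ + deriv (deriv g) θ))
    (f : ℝ → ℝ) (hf : ContDiff ℝ (⊤ : ℕ∞) f)
    (hfpos : ∀ t, 0 ≤ t → 0 < f t)
    (hfmono : MonotoneOn f (Set.Ici 0))
    (hf0 : f 0 = 1) :
    ¬ ∃ T' : ℝ, A / (2 * B) < T' ∧ ∃ u : ℝ → ℝ → ℝ,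
      ContDiff ℝ (⊤ : ℕ∞) (Function.uncurry u) ∧
      (∀ θ t, t ∈ Set.Icc 0 T' → 0 < u θ t) ∧
      (∀ θ t, u (θ + 2 * π) t = u θ t) ∧
      (∀ θ, u θ 0 = u₀ θ) ∧
      (∀ θ t, t ∈ Set.Icc 0 T' →
        pt u θ t =
          g θ / (g θ + deriv (deriv g) θ) * (u θ t) ^ 2 * pd (pd u) θ t
            + 2 * deriv g θ / (g θ + deriv (deriv g) θ) * (u θ t) ^ 2 * pd u θ t
            + (u θ t) ^ 3
            + deriv f t / f t * u θ t) := by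
  rintro ⟨T', hT, u, hu, hupos, huper, hu0, hpde⟩
  have hg₁ : ContDiff ℝ (⊤ : ℕ∞) (deriv g) := (contDiff_infty_iff_deriv.1 hg).2
  have hg₂ : ContDiff ℝ (⊤ : ℕ∞) (deriv (deriv g)) := (contDiff_infty_iff_deriv.1 hg₁).2
  have dg : ∀ θ, HasDerivAt g (deriv g θ) θ := fun θ =>
    (hg.differentiable (by simp) θ).hasDerivAt
  have dg₁ : ∀ θ, HasDerivAt (deriv g) (deriv (deriv g) θ) θ := fun θ =>
    (hg₁.differentiable (by simp) θ).hasDerivAt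
  have df : ∀ t, HasDerivAt f (deriv f t) t := fun t =>
    (hf.differentiable (by simp) t).hasDerivAt
  have cg := hg.continuous
  have cg₁ := hg₁.continuous
  have cg₂ := hg₂.continuous
  have cf := hf.continuous
  obtain ⟨hux, dux⟩ := contDiff_pd hu
  obtain ⟨huxx, duxx⟩ := contDiff_pd hux
  have cu : Continuous fun q : ℝ × ℝ => u q.1 q.2 := hu.continuous
  have cux : Continuous fun q : ℝ × ℝ => pd u q.1 q.2 := hux.continuous
  have cuxx : Continuous fun q : ℝ × ℝ => pd (pd u) q.1 q.2 := huxx.continuous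
  have hg2per : ∀ θ, g (θ + 2 * π) = g θ := fun θ => by
    rw [two_mul, ← add_assoc, hgper, hgper]
  -- the initial radius of curvature
  obtain ⟨w₀, hw₀⟩ : ∃ w₀ : ℝ → ℝ, ∀ θ, w₀ θ = (g θ + deriv (deriv g) θ) / u₀ θ :=
    ⟨_, fun _ => rfl⟩
  have cw₀ : Continuous w₀ := by
    rw [funext hw₀]
    exact (cg.add cg₂).div hu₀.continuous fun θ => (hu₀pos θ).ne'
  have w₀pos : ∀ θ, 0 ≤ w₀ θ := fun θ => by
    rw [hw₀]
    exact (div_pos (hggpos θ) (hu₀pos θ)).le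
  simp only [← hw₀] at hclose1 hclose2 hF₀
  have hA' : 2 * A = ∫ θ in (0:ℝ)..2 * π, w₀ θ * supportFun w₀ θ := by
    rw [hA, ← mul_assoc, mul_one_div_cancel two_ne_zero, one_mul]
    refine intervalIntegral.integral_congr fun θ _ => ?_
    have d : HasDerivAt F₀ (-(w₀ θ * sin θ), w₀ θ * cos θ) θ := by
      rw [funext hF₀]
      exact ((Continuous.integral_hasStrictDerivAt (by fun_prop) 0 θ).hasDerivAt.neg).prodMk
        (Continuous.integral_hasStrictDerivAt (by fun_prop) 0 θ).hasDerivAt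
    simp only [d.deriv, hF₀, wedge, supportFun]
    ring
  have hBpos : 0 < B := by
    rw [hB]
    have : 0 < ∫ θ in (0:ℝ)..2 * π, g θ * (g θ + deriv (deriv g) θ) :=
      intervalIntegral.intervalIntegral_pos_of_pos
        (by apply Continuous.intervalIntegrable; fun_prop)
        (fun θ => mul_pos (hgpos θ) (hggpos θ)) two_pi_pos
    positivity
  have hApos : 0 ≤ A := by
    have : 0 ≤ 2 * A := by
      rw [hA']
      exact intervalIntegral.integral_nonneg two_pi_pos.le fun θ hθ =>
        mul_nonneg (w₀pos θ) (supportFun_nonneg cw₀ w₀pos hclose2 hclose1 hθ)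
    linarith
  have hT0 : 0 < T' := lt_of_le_of_lt (by positivity) hT
  -- time is clamped to the existence interval, where `u` and `f` are known to be positive
  obtain ⟨c, hcc, hcmem, hcid⟩ : ∃ c : ℝ → ℝ, Continuous c ∧ (∀ t, c t ∈ Icc 0 T') ∧
      ∀ t ∈ Icc 0 T', c t = t :=
    ⟨fun t => projIcc 0 T' hT0.le t, continuous_subtype_val.comp continuous_projIcc,
      fun t => (projIcc 0 T' hT0.le t).2, fun t ht => by simp only [projIcc_of_mem _ ht]⟩
  obtain ⟨W, hW⟩ : ∃ W : ℝ → ℝ → ℝ, ∀ t θ,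
      W t θ = (g θ + deriv (deriv g) θ) * f (c t) / u θ (c t) := ⟨_, fun _ _ => rfl⟩
  have cW : Continuous W.uncurry := by
    rw [show W = _ from funext fun t => funext (hW t)]
    refine Continuous.div (f := fun q : ℝ × ℝ => (g q.2 + deriv (deriv g) q.2) * f (c q.1))
      (g := fun q : ℝ × ℝ => u q.2 (c q.1)) (by fun_prop) ?_ fun q =>
      (hupos _ _ (hcmem _)).ne'
    exact cu.comp (continuous_snd.prodMk (hcc.comp continuous_fst))
  have cWt : ∀ t, Continuous (W t) := fun t => cW.comp (Continuous.prodMk_right t)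
  have Wpos : ∀ t θ, 0 ≤ W t θ := fun t θ => by
    rw [hW]
    exact (div_pos (mul_pos (hggpos θ) (hfpos _ (hcmem t).1)) (hupos _ _ (hcmem t))).le
  have hW0 : W 0 = w₀ := by
    ext θ
    rw [hW, hw₀, hcid 0 ⟨le_rfl, hT0.le⟩, hf0, mul_one, hu0]
  obtain ⟨P, hP⟩ : ∃ P : ℝ → ℝ → ℝ, ∀ t θ, P t θ = f t * (g θ * u θ t) := ⟨_, fun _ _ => rfl⟩
  obtain ⟨P₁, hP₁⟩ : ∃ P₁ : ℝ → ℝ → ℝ, ∀ t θ,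
      P₁ t θ = f t * (deriv g θ * u θ t + g θ * pd u θ t) := ⟨_, fun _ _ => rfl⟩
  obtain ⟨P₂, hP₂⟩ : ∃ P₂ : ℝ → ℝ → ℝ, ∀ t θ, P₂ t θ = f t * (deriv (deriv g) θ * u θ t
      + 2 * (deriv g θ * pd u θ t) + g θ * pd (pd u) θ t) := ⟨_, fun _ _ => rfl⟩
  have cP : Continuous P.uncurry := by
    have := cu.comp continuous_swap
    rw [show P = _ from funext fun t => funext (hP t)]
    exact (cf.comp continuous_fst).mul ((cg.comp continuous_snd).mul this)
  have cP₂ : Continuous P₂.uncurry := by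
    rw [show P₂ = _ from funext fun t => funext (hP₂ t)]
    exact (cf.comp continuous_fst).mul ((((cg₂.comp continuous_snd).mul
      (cu.comp continuous_swap)).add (continuous_const.mul ((cg₁.comp continuous_snd).mul
      (cux.comp continuous_swap)))).add ((cg.comp continuous_snd).mul
      (cuxx.comp continuous_swap)))
  have dP : ∀ t θ, HasDerivAt (P t) (P₁ t θ) θ := fun t θ => by
    rw [funext (hP t), hP₁]
    exact ((dg θ).mul (dux θ t)).const_mul _
  have dP₁ : ∀ t θ, HasDerivAt (P₁ t) (P₂ t θ) θ := fun t θ => by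
    rw [funext (hP₁ t), hP₂]
    exact ((((dg₁ θ).mul (dux θ t)).add ((dg θ).mul (duxx θ t))).const_mul _).congr_deriv
      (by ring)
  have Pper : ∀ t, Function.Periodic (P t) (2 * π) := fun t θ => by
    rw [hP, hP, hg2per, huper]
  have P₁per : ∀ t, Function.Periodic (P₁ t) (2 * π) := fun t => (Pper t).of_hasDerivAt (dP t)
  have cPt : ∀ t, Continuous (P t) := fun t => cP.comp (Continuous.prodMk_right t)
  have cP₂t : ∀ t, Continuous (P₂ t) := fun t => cP₂.comp (Continuous.prodMk_right t)
  have dW : ∀ t ∈ Ioo 0 T', ∀ θ, HasDerivAt (fun r => W r θ) (-(P₂ t θ + P t θ)) t := by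
    intro t ht θ
    have ht' := Ioo_subset_Icc_self ht
    have h0 := (hupos θ t ht').ne'
    have h1 := (hfpos t ht'.1).ne'
    have h2 := (hggpos θ).ne'
    have d : HasDerivAt (fun r => (g θ + deriv (deriv g) θ) * f r / u θ r)
        (-(P₂ t θ + P t θ)) t := by
      refine (((df t).const_mul _).div (hasDerivAt_pt hu θ t) h0).congr_deriv ?_
      rw [hpde θ t ht', hP₂, hP]
      field_simp
      ring
    refine d.congr_of_eventuallyEq ?_
    filter_upwards [isOpen_Ioo.mem_nhds ht] with r hr
    rw [hW, hcid r (Ioo_subset_Icc_self hr)]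
  have Wcos : ∀ t ∈ Icc 0 T', ∫ σ in (0:ℝ)..2 * π, W t σ * cos σ = 0 := fun t ht => by
    rw [eq_left_of_hasDerivAt_zero (φ := fun t => ∫ σ in (0:ℝ)..2 * π, W t σ * cos σ)
      (intervalIntegral.continuous_parametric_intervalIntegral_of_continuous'
        (f := fun t σ => W t σ * cos σ) (cW.mul (by fun_prop)) _ _) (fun r hr => ?_) ht]
    · simpa only [hW0] using hclose2
    · refine (hasDerivAt_integral_mul (V := fun t θ => -(P₂ t θ + P t θ)) cW (cP₂.add cP).neg
        (isOpen_Ioo.mem_nhds hr) dW continuous_cos _ _).congr_deriv ?_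
      simp only [neg_mul, intervalIntegral.integral_neg]
      rw [integral_add_second_deriv_mul_cos (dP r) (dP₁ r) (cP₂t r), (P₁per r).eq]
      simp
  have Wsin : ∀ t ∈ Icc 0 T', ∫ σ in (0:ℝ)..2 * π, W t σ * sin σ = 0 := fun t ht => by
    rw [eq_left_of_hasDerivAt_zero (φ := fun t => ∫ σ in (0:ℝ)..2 * π, W t σ * sin σ)
      (intervalIntegral.continuous_parametric_intervalIntegral_of_continuous'
        (f := fun t σ => W t σ * sin σ) (cW.mul (by fun_prop)) _ _) (fun r hr => ?_) ht]
    · simpa only [hW0] using hclose1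
    · refine (hasDerivAt_integral_mul (V := fun t θ => -(P₂ t θ + P t θ)) cW (cP₂.add cP).neg
        (isOpen_Ioo.mem_nhds hr) dW continuous_sin _ _).congr_deriv ?_
      simp only [neg_mul, intervalIntegral.integral_neg]
      rw [integral_add_second_deriv_mul_sin (dP r) (dP₁ r) (cP₂t r), (Pper r).eq]
      simp
  -- twice the enclosed area, which decreases at rate at least `4 * B`
  set H : ℝ → ℝ := fun t => ∫ θ in (0:ℝ)..2 * π, W t θ * supportFun (W t) θ with hH
  have cH : Continuous H := intervalIntegral.continuous_parametric_intervalIntegral_of_continuous'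
    (f := fun t θ => W t θ * supportFun (W t) θ) (cW.mul (continuous_supportFun cW)) _ _
  have dH : ∀ t ∈ Ioo 0 T', HasDerivAt H (-(4 * B * f t ^ 2)) t := by
    intro t ht
    have ht' := Ioo_subset_Icc_self ht
    refine (hasDerivAt_integral_mul_supportFun cW cP₂ cP dP dP₁ isOpen_Ioo ht dW
      (Wcos t ht') (Wsin t ht')).congr_deriv ?_
    have e : ∀ θ, P t θ * W t θ = f t ^ 2 * (g θ * (g θ + deriv (deriv g) θ)) := fun θ => by
      have h0 := (hupos θ t ht').ne'
      rw [hP, hW, hcid t ht']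
      field_simp
    simp only [e, intervalIntegral.integral_const_mul]
    rw [hB]
    ring
  have anti : AntitoneOn (fun t => H t + 4 * B * t) (Icc 0 T') := by
    have d : ∀ t ∈ Ioo 0 T', HasDerivAt (fun t => H t + 4 * B * t)
        (-(4 * B * f t ^ 2) + 4 * B * 1) t := fun t ht =>
      (dH t ht).add ((hasDerivAt_id t).const_mul _)
    refine antitoneOn_of_deriv_nonpos (convex_Icc _ _) (by fun_prop) ?_ ?_ <;>
      rw [interior_Icc]
    · exact fun t ht => (d t ht).differentiableAt.differentiableWithinAt
    · intro t ht
      rw [(d t ht).deriv]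
      have h1 : 1 ≤ f t := hf0 ▸ hfmono (mem_Ici.2 le_rfl) (mem_Ici.2 ht.1.le) ht.1.le
      nlinarith [one_le_pow₀ h1 (n := 2)]
  have hfin := anti ⟨le_rfl, hT0.le⟩ ⟨hT0.le, le_rfl⟩ hT0.le
  have hH0 : H 0 = 2 * A := by
    rw [hA']
    simp only [hH, hW0]
  have hHT : 0 ≤ H T' := intervalIntegral.integral_nonneg two_pi_pos.le fun θ hθ =>
    mul_nonneg (Wpos _ θ) (supportFun_nonneg (cWt _) (Wpos _) (Wcos _ ⟨hT0.le, le_rfl⟩)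
      (Wsin _ ⟨hT0.le, le_rfl⟩) hθ)
  rw [div_lt_iff₀ (by positivity)] at hT
  simp only [hH0] at hfin
  linarith
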